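/- Let k, l, m, n be integers with k, m, n positive and l ≥ 0, satisfying (l+1)/m + 2(k+l+1)/n < 1. Then there is no non-polynomial rational function H(ζ) = A (ζ−α_1)^{n_1}⋯(ζ−α_s)^{n_s} / ((ζ−β_1)^{n_1'}⋯(ζ−β_t)^{n_t'}) (with A ≠ 0, the α_i and β_j distinct points, all n_i ≥ n and all n_j' ≥ n) such that H(0) ≠ 0, the total pole degree N' = Σ_j n_j' satisfies N' ≥ N = Σ_i n_i, and every zero of H^{(k)}(ζ) − ζ^l has multiplicity at least m. -/

import Mathlib

open Complex Topology Filter Set MeasureTheory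
open scoped ENNReal NNReal Classical

noncomputable section


/-- The chordal (spherical) distance on the Riemann sphere `ℂ ∪ {∞}`. -/
def sphDist (a b : OnePoint ℂ) : ℝ :=
  Option.elim a (Option.elim b 0 fun w => 1 / Real.sqrt (1 + ‖w‖ ^ 2))
    fun z => Option.elim b (1 / Real.sqrt (1 + ‖z‖ ^ 2))
      fun w => ‖z - w‖ / (Real.sqrt (1 + ‖z‖ ^ 2) * Real.sqrt (1 + ‖w‖ ^ 2))

/-- The natural Riemann-sphere-valued version of a meromorphic function:
at points where the function blows up (poles) the value is `∞`. -/
def toSphere (f : ℂ → ℂ) : ℂ → OnePoint ℂ := fun z =>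
  if Tendsto (fun w => ‖f w‖) (𝓝[≠] z) atTop then OnePoint.infty else (f z : OnePoint ℂ)

/-- A meromorphic function given by an honest representative: at each point of `D` it is
either continuous (analytic points) or blows up (a pole). -/
def MeromorphicNiceOn (f : ℂ → ℂ) (D : Set ℂ) : Prop :=
  MeromorphicOn f D ∧ ∀ z ∈ D, ContinuousAt f z ∨ Tendsto (fun w => ‖f w‖) (𝓝[≠] z) atTop

/-- The order (multiplicity) of a meromorphic function at a point: positive for a zero of that
multiplicity, negative of the multiplicity for a pole, `⊤` if the function vanishes identically
near the point, and junk value `0` when not defined. -/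
def merOrder (f : ℂ → ℂ) (z : ℂ) : WithTop ℤ :=
  if ∀ᶠ w in 𝓝[≠] z, f w = 0 then ⊤
  else if h : ∃ n : ℤ, ∃ g : ℂ → ℂ, AnalyticAt ℂ g z ∧ g z ≠ 0 ∧
      ∀ᶠ w in 𝓝[≠] z, f w = (w - z) ^ n * g w
    then (h.choose : WithTop ℤ) else 0

/-- `F j → g` spherically uniformly on compact subsets of `D`. -/
def ConvSphLocUnif (F : ℕ → ℂ → ℂ) (g : ℂ → ℂ) (D : Set ℂ) : Prop :=
  ∀ K ⊆ D, IsCompact K → ∀ ε > 0, ∀ᶠ j in atTop, ∀ z ∈ K,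
    sphDist (toSphere (F j) z) (toSphere g z) < ε

/-- `F j → ∞` spherically uniformly on compact subsets of `D`. -/
def ConvInftyLocUnif (F : ℕ → ℂ → ℂ) (D : Set ℂ) : Prop :=
  ∀ K ⊆ D, IsCompact K → ∀ ε > 0, ∀ᶠ j in atTop, ∀ z ∈ K,
    sphDist (toSphere (F j) z) OnePoint.infty < ε

/-- A family of meromorphic functions is normal in `D` if every sequence from the family has a
subsequence converging spherically uniformly on compact subsets of `D` to a meromorphic
function or to `∞`. -/
def NormalFamilyOn (𝓕 : Set (ℂ → ℂ)) (D : Set ℂ) : Prop :=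
  ∀ f : ℕ → ℂ → ℂ, (∀ j, f j ∈ 𝓕) → ∃ φ : ℕ → ℕ, StrictMono φ ∧
    ((∃ g : ℂ → ℂ, MeromorphicNiceOn g D ∧ ConvSphLocUnif (fun j => f (φ j)) g D) ∨
      ConvInftyLocUnif (fun j => f (φ j)) D)

/-- A sequence of meromorphic functions is normal in `D` if every subsequence has a further
subsequence converging spherically uniformly on compact subsets of `D` to a meromorphic
function or to `∞`. -/
def NormalSeqOn (f : ℕ → ℂ → ℂ) (D : Set ℂ) : Prop :=
  ∀ φ : ℕ → ℕ, StrictMono φ → ∃ σ : ℕ → ℕ, StrictMono σ ∧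
    ((∃ g : ℂ → ℂ, MeromorphicNiceOn g D ∧ ConvSphLocUnif (fun j => f (φ (σ j))) g D) ∨
      ConvInftyLocUnif (fun j => f (φ (σ j))) D)

open Polynomial in
/-- The numerator of the derivative of `∏ i, (X - γ i) ^ e i * u`, once the factor
`∏ i, (X - γ i) ^ (e i - 1)` has been extracted. -/
def derivNumerator {ι : Type*} [Fintype ι] (γ : ι → ℂ) (e : ι → ℤ) (u : ℂ[X]) : ℂ[X] :=
  derivative u * ∏ i, (X - C (γ i)) +
    u * ∑ i, C (e i : ℂ) * ∏ j ∈ Finset.univ.erase i, (X - C (γ j))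

open Polynomial in
/-- The numerator of the `r`-th derivative of `∏ i, (X - γ i) ^ e i * u`, once the factor
`∏ i, (X - γ i) ^ (e i - r)` has been extracted. -/
def iteratedDerivNumerator {ι : Type*} [Fintype ι] (γ : ι → ℂ) (e : ι → ℤ) (u : ℂ[X]) : ℕ → ℂ[X]
  | 0 => u
  | r + 1 => derivNumerator γ (fun i => e i - r) (iteratedDerivNumerator γ e u r)

section DerivNumerator

open Polynomial

variable {ι : Type*} [Fintype ι] {γ : ι → ℂ} {e : ι → ℤ}

theorem derivNumerator_sub (u v : ℂ[X]) :
    derivNumerator γ e (u - v) = derivNumerator γ e u - derivNumerator γ e v := by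
  simp only [derivNumerator, derivative_sub]
  ring

theorem iteratedDerivNumerator_sub (u v : ℂ[X]) (r : ℕ) :
    iteratedDerivNumerator γ e (u - v) r =
      iteratedDerivNumerator γ e u r - iteratedDerivNumerator γ e v r := by
  induction r with
  | zero => rfl
  | succ r ih => simp only [iteratedDerivNumerator, ih, derivNumerator_sub]

theorem natDegree_derivNumerator_le (hι : 1 ≤ Fintype.card ι) (u : ℂ[X]) :
    (derivNumerator γ e u).natDegree ≤ u.natDegree + (Fintype.card ι - 1) := by
  refine natDegree_add_le_of_degree_le ?_ ?_
  · rcases Nat.eq_zero_or_pos u.natDegree with h | h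
    · rw [eq_C_of_natDegree_eq_zero h]
      simp
    · refine natDegree_mul_le.trans ?_
      have h1 := natDegree_derivative_le u
      have h2 : (∏ i, (X - C (γ i))).natDegree = Fintype.card ι := by
        simp
      omega
  · refine natDegree_mul_le.trans (Nat.add_le_add_left ?_ _)
    refine natDegree_sum_le_of_forall_le _ _ fun i _ => (natDegree_C_mul_le _ _).trans ?_
    simp

theorem natDegree_iteratedDerivNumerator_le (hι : 1 ≤ Fintype.card ι) (u : ℂ[X]) (r : ℕ) :
    (iteratedDerivNumerator γ e u r).natDegree ≤ u.natDegree + r * (Fintype.card ι - 1) := by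
  induction r with
  | zero => simp [iteratedDerivNumerator]
  | succ r ih =>
    refine (natDegree_derivNumerator_le hι _).trans ?_
    rw [add_one_mul]
    omega

theorem pow_dvd_derivNumerator {u : ℂ[X]} {z : ℂ} {M : ℕ} (h : (X - C z) ^ (M + 1) ∣ u) :
    (X - C z) ^ M ∣ derivNumerator γ e u :=
  dvd_add (Dvd.dvd.mul_right (by simpa using pow_sub_one_dvd_derivative_of_pow_dvd h) _)
    (Dvd.dvd.mul_right ((pow_dvd_pow _ M.le_succ).trans h) _)

theorem pow_dvd_iteratedDerivNumerator {u : ℂ[X]} {z : ℂ} (r : ℕ) {M : ℕ}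
    (h : (X - C z) ^ (M + r) ∣ u) : (X - C z) ^ M ∣ iteratedDerivNumerator γ e u r := by
  induction r generalizing M with
  | zero => exact h
  | succ r ih =>
    refine pow_dvd_derivNumerator (ih ?_)
    rwa [add_right_comm, add_assoc]

theorem eval_derivNumerator_self (u : ℂ[X]) (i : ι) :
    (derivNumerator γ e u).eval (γ i) =
      u.eval (γ i) * (e i * ∏ j ∈ Finset.univ.erase i, (γ i - γ j)) := by
  rw [derivNumerator, eval_add, eval_mul, eval_mul, eval_prod, eval_finsetSum,
    Finset.prod_eq_zero (Finset.mem_univ i) (by simp), mul_zero, zero_add,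
    Finset.sum_eq_single i]
  · simp [eval_prod]
  · intro j _ hj
    rw [eval_mul, eval_prod, Finset.prod_eq_zero (i := i) (by simp [hj.symm]) (by simp), mul_zero]
  · simp

theorem eval_iteratedDerivNumerator_ne_zero (hγ : Function.Injective γ) {u : ℂ[X]} {i : ι}
    (hu : u.eval (γ i) ≠ 0) (hi : e i < 0) (r : ℕ) :
    (iteratedDerivNumerator γ e u r).eval (γ i) ≠ 0 := by
  induction r with
  | zero => exact hu
  | succ r ih =>
    rw [iteratedDerivNumerator, eval_derivNumerator_self]
    refine mul_ne_zero ih (mul_ne_zero ?_ (Finset.prod_ne_zero_iff.mpr fun j hj => ?_))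
    · exact_mod_cast (by omega : e i - (r : ℤ) ≠ 0)
    · exact sub_ne_zero.mpr fun h => Finset.ne_of_mem_erase hj (hγ h).symm

theorem hasDerivAt_prod_zpow_mul_eval (u : ℂ[X]) {w : ℂ} (hw : ∀ i, w ≠ γ i) :
    HasDerivAt (fun w => (∏ i, (w - γ i) ^ e i) * u.eval w)
      ((∏ i, (w - γ i) ^ (e i - 1)) * (derivNumerator γ e u).eval w) w := by
  have hne : ∀ i, w - γ i ≠ 0 := fun i => sub_ne_zero.mpr (hw i)
  have h1 : HasDerivAt (fun w => ∏ i, (w - γ i) ^ e i)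
      (∑ i, (∏ j ∈ Finset.univ.erase i, (w - γ j) ^ e j) • ((e i : ℂ) * (w - γ i) ^ (e i - 1))) w := by
    refine HasDerivAt.fun_finsetProd fun i _ => ?_
    exact (hasDerivAt_zpow (e i) (w - γ i) (Or.inl (hne i))).comp_sub_const w (γ i)
  refine (h1.mul (u.hasDerivAt w)).congr_deriv ?_
  have key : ∀ s : Finset ι, ∏ i ∈ s, (w - γ i) ^ e i =
      (∏ i ∈ s, (w - γ i) ^ (e i - 1)) * ∏ i ∈ s, (w - γ i) := fun s => by
    rw [← Finset.prod_mul_distrib]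
    exact Finset.prod_congr rfl fun i _ => by rw [← zpow_add_one₀ (hne i), sub_add_cancel]
  simp only [derivNumerator, eval_add, eval_mul, eval_prod, eval_finsetSum, eval_sub, eval_X,
    eval_C, smul_eq_mul]
  rw [mul_add, add_comm, key]
  congr 1
  · ring
  · rw [Finset.sum_mul, Finset.mul_sum Finset.univ _ (eval w u), Finset.mul_sum]
    refine Finset.sum_congr rfl fun i _ => ?_
    rw [key, ← Finset.mul_prod_erase Finset.univ _ (Finset.mem_univ i)]
    ring

theorem eventually_forall_ne {w : ℂ} (hw : ∀ i, w ≠ γ i) : ∀ᶠ x in 𝓝 w, ∀ i, x ≠ γ i :=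
  eventually_all.mpr fun i => isOpen_ne.mem_nhds (hw i)

theorem iteratedDeriv_eq_prod_zpow_mul_eval {u : ℂ[X]} {f : ℂ → ℂ}
    (hf : ∀ w, (∀ i, w ≠ γ i) → f w = (∏ i, (w - γ i) ^ e i) * u.eval w) (r : ℕ) {w : ℂ}
    (hw : ∀ i, w ≠ γ i) :
    iteratedDeriv r f w =
      (∏ i, (w - γ i) ^ (e i - r)) * (iteratedDerivNumerator γ e u r).eval w := by
  induction r generalizing w with
  | zero => simpa [iteratedDerivNumerator] using hf w hw
  | succ r ih =>
    have hev := (eventually_forall_ne hw).mono fun x hx => ih hx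
    rw [iteratedDeriv_succ, EventuallyEq.deriv_eq hev, (hasDerivAt_prod_zpow_mul_eval _ hw).deriv]
    simp [iteratedDerivNumerator, sub_sub]

theorem eq_of_eval_eq_of_forall_ne {p q : ℂ[X]}
    (h : ∀ w, (∀ i, w ≠ γ i) → p.eval w = q.eval w) : p = q := by
  refine eq_of_infinite_eval_eq p q ((Set.finite_range γ).infinite_compl.mono fun w hw => ?_)
  exact h w fun i hi => hw ⟨i, hi.symm⟩

end DerivNumerator

theorem merOrder_eq_of_eventually_eq {f g : ℂ → ℂ} {z : ℂ} {n : ℕ} (hg : AnalyticAt ℂ g z)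
    (hgz : g z ≠ 0) (h : ∀ᶠ w in 𝓝[≠] z, f w = (w - z) ^ n * g w) :
    merOrder f z = ((n : ℤ) : WithTop ℤ) := by
  have hex : ∃ n : ℤ, ∃ g : ℂ → ℂ, AnalyticAt ℂ g z ∧ g z ≠ 0 ∧
      ∀ᶠ w in 𝓝[≠] z, f w = (w - z) ^ n * g w := ⟨n, g, hg, hgz, by simpa using h⟩
  have hmer : MeromorphicAt f z := by
    refine MeromorphicAt.congr (f := fun w => (w - z) ^ n * g w) ?_ (h.mono fun w hw => hw.symm)
    fun_prop
  have hord : ∀ j : ℤ, (∃ g : ℂ → ℂ, AnalyticAt ℂ g z ∧ g z ≠ 0 ∧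
      ∀ᶠ w in 𝓝[≠] z, f w = (w - z) ^ j * g w) → meromorphicOrderAt f z = j := fun j hj =>
    (meromorphicOrderAt_eq_int_iff hmer).mpr (by simpa using hj)
  have hn := hord n ⟨g, hg, hgz, by simpa using h⟩
  have hne : ¬ ∀ᶠ w in 𝓝[≠] z, f w = 0 := fun h0 => by
    rw [meromorphicOrderAt_eq_top_iff.mpr h0] at hn
    simp at hn
  rw [merOrder, if_neg hne, dif_pos hex]
  exact (hord _ hex.choose_spec).symm.trans hn

open Polynomial in
theorem merOrder_eval_mul {p : ℂ[X]} (hp : p ≠ 0) {f h : ℂ → ℂ} {z : ℂ} (hh : AnalyticAt ℂ h z)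
    (hz : h z ≠ 0) (hf : ∀ᶠ w in 𝓝 z, f w = h w * p.eval w) :
    merOrder f z = ((p.rootMultiplicity z : ℤ) : WithTop ℤ) := by
  obtain ⟨q, hq, hqz⟩ := exists_eq_pow_rootMultiplicity_mul_and_not_dvd p hp z
  refine merOrder_eq_of_eventually_eq (g := fun w => h w * q.eval w) ?_ ?_ ?_
  · exact hh.mul (AnalyticOnNhd.eval_polynomial q z (mem_univ z))
  · exact mul_ne_zero hz fun h0 => hqz (dvd_iff_isRoot.mpr h0)
  · refine (hf.filter_mono nhdsWithin_le_nhds).mono fun w hw => ?_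
    rw [hw]
    nth_rw 1 [hq]
    simp only [eval_mul, eval_pow, eval_sub, eval_X, eval_C]
    ring

open Polynomial in
/-- If every root `z` of `U` has multiplicity at least `r`, and `G ≠ 0` vanishes at each such `z`
with order at least that multiplicity minus `r`, then `G` is of large degree. -/
theorem natDegree_le_of_forall_pow_dvd {U G : ℂ[X]} (hG : G ≠ 0) (r : ℕ)
    (h : ∀ z ∈ U.roots.toFinset, (X - C z) ^ (U.rootMultiplicity z - r) ∣ G) :
    U.natDegree ≤ r * U.roots.toFinset.card + G.natDegree := by
  have hdvd : ∏ z ∈ U.roots.toFinset, (X - C z) ^ (U.rootMultiplicity z - r) ∣ G :=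
    Finset.prod_dvd_of_coprime (fun a _ b _ hab =>
      (isCoprime_X_sub_C_of_isUnit_sub (sub_ne_zero.mpr hab).isUnit).pow) h
  have hdeg := natDegree_le_of_dvd hdvd hG
  rw [natDegree_prod_of_monic _ _ fun z _ => (monic_X_sub_C z).pow _] at hdeg
  simp only [natDegree_pow, natDegree_X_sub_C, mul_one] at hdeg
  have hcard : U.natDegree = ∑ z ∈ U.roots.toFinset, U.rootMultiplicity z := by
    rw [(IsAlgClosed.splits U).natDegree_eq_card_roots, ← Multiset.toFinset_sum_count_eq]
    simp only [count_roots]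
  calc U.natDegree ≤ ∑ z ∈ U.roots.toFinset, (r + (U.rootMultiplicity z - r)) :=
        hcard.trans_le (Finset.sum_le_sum fun z _ => by omega)
    _ ≤ _ := by
        rw [Finset.sum_add_distrib, Finset.sum_const, smul_eq_mul, mul_comm]
        omega

open Polynomial in
theorem mul_card_roots_le_natDegree {U : ℂ[X]} {m : ℕ}
    (h : ∀ z ∈ U.roots.toFinset, m ≤ U.rootMultiplicity z) :
    m * U.roots.toFinset.card ≤ U.natDegree := by
  refine le_trans ?_ (card_roots' U)
  rw [← Multiset.toFinset_sum_count_eq, mul_comm, ← smul_eq_mul]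
  exact Finset.card_nsmul_le_sum _ _ _ fun z hz => (h z hz).trans_eq (count_roots U).symm

theorem no_degree_balance {a m n K N T q s t : ℕ} (hm : 1 ≤ m) (hn : 1 ≤ n)
    (hcond : (a : ℝ) / m + 2 * ((K : ℝ) / n) < 1) (hs : n * s ≤ N) (ht : n * t ≤ N)
    (hNT : N ≤ T) (hT : 0 < T) (hq : m * q ≤ T) (h : T ≤ a * q + K * (s + t - 1)) : False := by
  have hm' : (0 : ℝ) < m := by exact_mod_cast hm
  have hn' : (0 : ℝ) < n := by exact_mod_cast hn
  have h' : T ≤ a * q + K * (s + t) :=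
    h.trans (Nat.add_le_add_left (Nat.mul_le_mul_left _ (Nat.sub_le _ _)) _)
  have hT' : (T : ℝ) ≤ a * q + K * (s + t) := by exact_mod_cast h'
  have hq' : (q : ℝ) ≤ T / m := by
    rw [le_div_iff₀' hm']; exact_mod_cast hq
  have hs' : (s : ℝ) ≤ T / n := by
    rw [le_div_iff₀' hn']; exact_mod_cast hs.trans hNT
  have ht' : (t : ℝ) ≤ T / n := by
    rw [le_div_iff₀' hn']; exact_mod_cast ht.trans hNT
  have h1 : (a : ℝ) * q ≤ a * (T / m) := by gcongr
  have h2 : (K : ℝ) * (s + t) ≤ K * (T / n + T / n) := by gcongr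
  have h3 : (a : ℝ) * (T / m) + K * (T / n + T / n) = T * (a / m + 2 * (K / n)) := by ring
  have hT0 : (0 : ℝ) < T := by exact_mod_cast hT
  nlinarith

open Polynomial in
/-- **Non-polynomial rational case non-existence claim.** If `(l+1)/m + 2(k+l+1)/n < 1`, there
is no non-polynomial rational function
`H(ζ) = A (ζ−α₁)^{n₁}⋯(ζ−α_s)^{n_s} / ((ζ−β₁)^{n₁'}⋯(ζ−β_t)^{n_t'})` with `A ≠ 0`, all
exponents at least `n`, `H 0 ≠ 0`, total pole degree at least total zero degree, and such that
every zero of `H⁽ᵏ⁾(ζ) − ζ^l` has multiplicity at least `m`. -/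
theorem no_rational_nonpolynomial (k m n : ℕ) (l : ℕ)
    (hk : 1 ≤ k) (hm : 1 ≤ m) (hn : 1 ≤ n)
    (hcond : ((l : ℝ) + 1) / m + 2 * (((k : ℝ) + (l : ℝ) + 1) / n) < 1)
    (s t : ℕ) (hs : 1 ≤ s) (ht : 1 ≤ t)  -- t ≥ 1 : H is non-polynomial
    (A : ℂ) (hA : A ≠ 0)
    (α : Fin s → ℂ) (β : Fin t → ℂ)
    (hα : Function.Injective α) (hβ : Function.Injective β) (hαβ : ∀ i j, α i ≠ β j)
    (ni : Fin s → ℕ) (nj : Fin t → ℕ) (hni : ∀ i, n ≤ ni i) (hnj : ∀ j, n ≤ nj j)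
    (H : ℂ → ℂ)
    (hH : ∀ ζ : ℂ, (∀ j, ζ ≠ β j) →
      H ζ = A * (∏ i, (ζ - α i) ^ (ni i)) / (∏ j, (ζ - β j) ^ (nj j)))
    -- H(0) ≠ 0 : the origin is neither a zero nor a pole of H
    (hα0 : ∀ i, α i ≠ 0) (hβ0 : ∀ j, β j ≠ 0)
    -- N' ≥ N
    (hNN' : ∑ i, ni i ≤ ∑ j, nj j)
    -- every zero of H⁽ᵏ⁾(ζ) − ζ^l has multiplicity at least m
    (hmult : ∀ z : ℂ, (∀ j, z ≠ β j) → iteratedDeriv k H z - z ^ l = 0 →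
      ((m : ℤ) : WithTop ℤ) ≤ merOrder (fun w => iteratedDeriv k H w - w ^ l) z) :
    False := by
  have hmn : l + 1 ≤ m ∧ k < n := by
    have hm' : (0 : ℝ) < m := by exact_mod_cast hm
    have hn' : (0 : ℝ) < n := by exact_mod_cast hn
    have h1 : (0 : ℝ) ≤ ((l : ℝ) + 1) / m := by positivity
    have h2 : (0 : ℝ) ≤ ((k : ℝ) + l + 1) / n := by positivity
    have h3 : ((l : ℝ) + 1) / m < 1 := by linarith
    have h4 : ((k : ℝ) + l + 1) / n < 1 := by linarith
    rw [div_lt_one (by assumption)] at h3 h4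
    have h3' : l + 1 < m := by exact_mod_cast h3
    have h4' : k + l + 1 < n := by exact_mod_cast h4
    omega
  obtain ⟨hlm, hkn⟩ := hmn
  have hki : ∀ i, k ≤ ni i := fun i => hkn.le.trans (hni i)
  set γ : Fin s ⊕ Fin t → ℂ := Sum.elim α β with hγdef
  have hγ : Function.Injective γ := hα.sumElim hβ hαβ
  set e : Fin s ⊕ Fin t → ℤ := Sum.elim (fun i => (ni i : ℤ)) (fun j => -(nj j : ℤ)) with he
  set e' : Fin s ⊕ Fin t → ℤ := Sum.elim (fun _ => 0) (fun j => -((nj j + k : ℕ) : ℤ)) with he'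
  set g : ℕ → ℂ[X] := iteratedDerivNumerator γ e (C A) with hg
  set P : ℂ[X] := ∏ i, (X - C (α i)) ^ (ni i - k) with hP
  set Q : ℂ[X] := ∏ j, (X - C (β j)) ^ (nj j + k) with hQ
  have hcard : Fintype.card (Fin s ⊕ Fin t) = s + t := by simp
  have hHγ : ∀ w, (∀ i, w ≠ γ i) → H w = (∏ i, (w - γ i) ^ e i) * (C A).eval w := fun w hw => by
    rw [hH w fun j => hw (Sum.inr j)]
    simp only [he, hγdef, Fintype.prod_sum_type, Sum.elim_inl, Sum.elim_inr, zpow_natCast,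
      zpow_neg, Finset.prod_inv_distrib, eval_C]
    ring
  have hexp : ∀ (r : ℕ) w, (∀ i, w ≠ γ i) →
      ∏ i, (w - γ i) ^ (e i - (k + r : ℕ)) = (∏ i, (w - γ i) ^ (e' i - r)) * P.eval w := by
    intro r w hw
    simp only [he, he', hγdef, Fintype.prod_sum_type, Sum.elim_inl, Sum.elim_inr, hP, eval_prod,
      eval_pow, eval_sub, eval_X, eval_C]
    rw [mul_right_comm, ← Finset.prod_mul_distrib]
    congr 1
    · refine Finset.prod_congr rfl fun i _ => ?_
      have hwi : w - α i ≠ 0 := sub_ne_zero.mpr (hw (Sum.inl i))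
      rw [← zpow_natCast _ (ni i - k), ← zpow_add₀ hwi, Nat.cast_sub (hki i)]
      congr 1
      push_cast
      ring
    · refine Finset.prod_congr rfl fun j _ => ?_
      congr 1
      push_cast
      ring
  have hne : ∀ (r : ℕ) w, (∀ i, w ≠ γ i) → ∏ i, (w - γ i) ^ (e' i - r) ≠ 0 := fun r w hw =>
    Finset.prod_ne_zero_iff.mpr fun i _ => zpow_ne_zero _ (sub_ne_zero.mpr (hw i))
  have hHk : ∀ w, (∀ i, w ≠ γ i) →
      iteratedDeriv k H w = (∏ i, (w - γ i) ^ e' i) * (P * g k).eval w := fun w hw => by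
    have h := hexp 0 w hw
    simp only [add_zero, Nat.cast_zero, sub_zero] at h
    rw [iteratedDeriv_eq_prod_zpow_mul_eval hHγ k hw, h, eval_mul, mul_assoc]
  have hpow : ∀ w, (∀ i, w ≠ γ i) →
      w ^ l = (∏ i, (w - γ i) ^ e' i) * (X ^ l * Q).eval w := fun w hw => by
    have h0 : ∏ j, (w - β j) ^ (nj j + k) ≠ 0 :=
      Finset.prod_ne_zero_iff.mpr fun j _ => pow_ne_zero _ (sub_ne_zero.mpr (hw (Sum.inr j)))
    simp only [he', hγdef, Fintype.prod_sum_type, Sum.elim_inl, Sum.elim_inr, zpow_natCast,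
      zpow_neg, zpow_zero, Finset.prod_inv_distrib, Finset.prod_const_one, eval_mul, eval_pow,
      eval_X, hQ, eval_prod, eval_sub, eval_C]
    field_simp
  set U : ℂ[X] := P * g k - X ^ l * Q with hU
  have hfU : ∀ w, (∀ i, w ≠ γ i) →
      iteratedDeriv k H w - w ^ l = (∏ i, (w - γ i) ^ e' i) * U.eval w := fun w hw => by
    rw [hHk w hw, hU, eval_sub, mul_sub, ← hpow w hw]
  have hkey : iteratedDerivNumerator γ e' U (l + 1) = P * g (k + (l + 1)) := by
    refine eq_of_eval_eq_of_forall_ne (γ := γ) fun w hw => ?_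
    have h1 := iteratedDeriv_eq_prod_zpow_mul_eval hHk (l + 1) hw
    have h2 := iteratedDeriv_eq_prod_zpow_mul_eval hpow (l + 1) hw
    have h3 := iteratedDeriv_eq_prod_zpow_mul_eval hHγ (k + (l + 1)) hw
    have h4 : iteratedDeriv (l + 1) (iteratedDeriv k H) = iteratedDeriv (k + (l + 1)) H := by
      simp only [iteratedDeriv_eq_iterate, ← Function.iterate_add_apply, add_comm]
    have h5 : iteratedDeriv (l + 1) (fun w : ℂ => w ^ l) w = 0 := by
      simp
    rw [h4, h3, hexp _ w hw, mul_assoc] at h1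
    have h1' := mul_left_cancel₀ (hne _ w hw) h1
    rw [h5] at h2
    have h2' := (mul_eq_zero.mp h2.symm).resolve_left (hne _ w hw)
    rw [hU, iteratedDerivNumerator_sub, eval_sub, ← h1', h2', sub_zero, eval_mul]
  have hgβ : ∀ (r : ℕ) j, (g r).eval (β j) ≠ 0 := fun r j =>
    eval_iteratedDerivNumerator_ne_zero (i := Sum.inr j) hγ (by simpa using hA)
      (by have := hnj j; simp only [he, Sum.elim_inr]; omega) r
  have hg0 : ∀ r, g r ≠ 0 := fun r h => hgβ r ⟨0, ht⟩ (by simp [h])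
  have hgdeg : ∀ r, (g r).natDegree ≤ r * (s + t - 1) := fun r => by
    have h := natDegree_iteratedDerivNumerator_le (γ := γ) (e := e) (by omega) (C A) r
    rwa [natDegree_C, zero_add, hcard] at h
  have hPdeg : P.natDegree + s * k = ∑ i, ni i := by
    rw [hP, natDegree_prod_of_monic _ _ fun i _ => (monic_X_sub_C (α i)).pow _]
    simp only [natDegree_pow, natDegree_X_sub_C, mul_one]
    calc ∑ i, (ni i - k) + s * k = ∑ i, ((ni i - k) + k) := by simp [Finset.sum_add_distrib]
      _ = _ := Finset.sum_congr rfl fun i _ => Nat.sub_add_cancel (hki i)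
  have hQmonic : Q.Monic := monic_prod_of_monic _ _ fun j _ => (monic_X_sub_C (β j)).pow _
  have hQdeg : (X ^ l * Q).natDegree = l + (∑ j, nj j + t * k) := by
    rw [((monic_X_pow l).natDegree_mul hQmonic), natDegree_X_pow, hQ,
      natDegree_prod_of_monic _ _ fun j _ => (monic_X_sub_C (β j)).pow _]
    simp [Finset.sum_add_distrib]
  have hlt : (P * g k).natDegree < (X ^ l * Q).natDegree := by
    have h1 := natDegree_mul_le (p := P) (q := g k)
    have h2 := hgdeg k
    have h3 : k * (s + t - 1) + k = s * k + t * k := by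
      rw [← mul_add_one, Nat.sub_add_cancel (by omega)]
      ring
    omega
  have hUdeg : U.natDegree = l + (∑ j, nj j + t * k) := by
    rw [hU, natDegree_sub_eq_right_of_natDegree_lt hlt, hQdeg]
  have hU0 : U ≠ 0 := by
    rintro h
    have : 0 < t * k := Nat.mul_pos ht hk
    rw [h, natDegree_zero] at hUdeg
    omega
  have hroot : ∀ z, U.eval z = 0 → ∀ i, z ≠ γ i := by
    rintro z hz (i | j) rfl
    · have hPz : P.eval (α i) = 0 := by
        rw [hP, eval_prod]
        refine Finset.prod_eq_zero (Finset.mem_univ i) ?_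
        have := hni i
        simp [show ni i - k ≠ 0 by omega]
      have hQz : Q.eval (α i) ≠ 0 := by
        rw [hQ, eval_prod]
        exact Finset.prod_ne_zero_iff.mpr fun j _ => by
          simpa using fun h => absurd (sub_eq_zero.mp h) (hαβ i j)
      simp [hU, hγdef, hPz, hQz, hα0 i] at hz
    · have hPz : P.eval (β j) ≠ 0 := by
        rw [hP, eval_prod]
        exact Finset.prod_ne_zero_iff.mpr fun i _ => by
          simpa using fun h => absurd (sub_eq_zero.mp h).symm (hαβ i j)
      have hQz : Q.eval (β j) = 0 := by
        rw [hQ, eval_prod]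
        refine Finset.prod_eq_zero (Finset.mem_univ j) ?_
        simpa using fun _ => (by omega : k ≠ 0)
      simp [hU, hγdef, hPz, hQz, hgβ] at hz
  have hmul : ∀ z ∈ U.roots.toFinset, m ≤ U.rootMultiplicity z := by
    intro z hz
    have hz0 : U.eval z = 0 := isRoot_of_mem_roots (Multiset.mem_toFinset.mp hz)
    have hzγ := hroot z hz0
    have h := hmult z (fun j => hzγ (Sum.inr j)) (by rw [hfU z hzγ, hz0, mul_zero])
    rw [merOrder_eval_mul hU0 (h := fun w => ∏ i, (w - γ i) ^ e' i) ?_ ?_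
      ((eventually_forall_ne hzγ).mono hfU)] at h
    · exact_mod_cast h
    · refine Finset.analyticAt_fun_prod _ fun i _ => ?_
      exact (analyticAt_id.sub analyticAt_const).zpow (sub_ne_zero.mpr (hzγ i))
    · simpa using hne 0 z hzγ
  have hdvd : ∀ z ∈ U.roots.toFinset,
      (X - C z) ^ (U.rootMultiplicity z - (l + 1)) ∣ g (k + (l + 1)) := by
    intro z hz
    have hz0 : U.eval z = 0 := isRoot_of_mem_roots (Multiset.mem_toFinset.mp hz)
    have h : (X - C z) ^ (U.rootMultiplicity z - (l + 1)) ∣ P * g (k + (l + 1)) := by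
      rw [← hkey]
      refine pow_dvd_iteratedDerivNumerator _ ?_
      rw [Nat.sub_add_cancel (hlm.trans (hmul z hz))]
      exact pow_rootMultiplicity_dvd U z
    refine IsCoprime.dvd_of_dvd_mul_left (IsCoprime.prod_right fun i _ => ?_) h
    exact (isCoprime_X_sub_C_of_isUnit_sub
      (sub_ne_zero.mpr (hroot z hz0 (Sum.inl i))).isUnit).pow
  have hbal := (natDegree_le_of_forall_pow_dvd (hg0 _) (l + 1) hdvd).trans
    (Nat.add_le_add_left (hgdeg _) _)
  have hs' : n * s ≤ ∑ i, ni i := by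
    simpa [mul_comm] using Finset.card_nsmul_le_sum Finset.univ ni n fun i _ => hni i
  have ht' : n * t ≤ ∑ j, nj j := by
    simpa [mul_comm] using Finset.card_nsmul_le_sum Finset.univ nj n fun j _ => hnj j
  have htk : 0 < t * k := Nat.mul_pos ht hk
  refine no_degree_balance hm hn ?_ (hs'.trans hNN') ht' (by omega : _ ≤ U.natDegree) (by omega)
    (mul_card_roots_le_natDegree hmul) hbal
  push_cast
  rwa [← add_assoc (k : ℝ)]

end
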